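/- Let N, E, A ∈ ℝ² be affinely independent, M = conv{N, E, A}, G = (N + E + A)/3 its centroid, ρ_M = √((1/36)·(‖N − A‖² + ‖E − N‖² + ‖A − E‖²)), ℓ = ‖N − E‖, τ = (N − E)/ℓ, and n the unit vector orthogonal to N − E with ⟨n, A − E⟩ > 0. Let φ be a C¹ vector field on a neighborhood of M whose divergence is constant on M, whose normal trace vanishes on the segments [N, A] and [E, A], and which satisfies the orthogonality relations ∫_M ⟨φ(x), x − E⟩ dx = 0 and ∫_M ⟨φ(x), x − N⟩ dx = 0. Write ψ(s) = ⟨φ(E + s·τ), n⟩ and set α = ∫₀^ℓ ψ(s) ds, α₁ = ∫₀^ℓ s·ψ(s) ds, α̃₁ = ∫₀^ℓ (ℓ − s)·ψ(s) ds, α₂ = ∫₀^ℓ s²·ψ(s) ds, α̃₂ = ∫₀^ℓ (ℓ − s)²·ψ(s) ds. Then: α₁ = ⟨G − E, τ⟩·α, α̃₁ = −⟨G − N, τ⟩·α, α₂ = (ρ_M² + ‖G − E‖²)·α, and α̃₂ = (ρ_M² + ‖G − N‖²)·α. (Proposition 3, 'First relations between momenta', relations (3.11).) -/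

import Mathlib

open MeasureTheory
open scoped RealInnerProductSpace

/-- The reference triangle with vertices `(0, 0)`, `(1, 0)` and `(0, 1)`. -/
def refTriangle : Set (ℝ × ℝ) := {p | 0 ≤ p.1 ∧ 0 ≤ p.2 ∧ p.1 + p.2 ≤ 1}

lemma isCompact_refTriangle : IsCompact refTriangle := by
  refine (isCompact_Icc (a := ((0, 0) : ℝ × ℝ)) (b := (1, 1))).of_isClosed_subset ?_ ?_
  · exact (isClosed_le continuous_const continuous_fst).inter
      ((isClosed_le continuous_const continuous_snd).inter
        (isClosed_le (continuous_fst.add continuous_snd) continuous_const))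
  · rintro ⟨u, v⟩ ⟨hu, hv, huv⟩
    simp only at hu hv huv
    exact ⟨⟨hu, hv⟩, ⟨by simp only; linarith, by simp only; linarith⟩⟩

lemma measurableSet_refTriangle : MeasurableSet refTriangle :=
  isCompact_refTriangle.measurableSet

/-- Fubini's theorem on the reference triangle. -/
lemma setIntegral_refTriangle {g : ℝ × ℝ → ℝ} (hg : ContinuousOn g refTriangle) :
    ∫ p in refTriangle, g p = ∫ u in (0 : ℝ)..1, ∫ v in (0 : ℝ)..(1 - u), g (u, v) := by
  have hint : Integrable (refTriangle.indicator g) (volume.prod volume) :=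
    (integrable_indicator_iff measurableSet_refTriangle).2
      (hg.integrableOn_compact isCompact_refTriangle)
  rw [← integral_indicator measurableSet_refTriangle, Measure.volume_eq_prod,
    integral_prod _ hint, intervalIntegral.integral_of_le zero_le_one,
    ← integral_Icc_eq_integral_Ioc, ← integral_indicator measurableSet_Icc]
  congr 1 with u
  by_cases hu : u ∈ Set.Icc (0 : ℝ) 1
  · rw [Set.indicator_of_mem hu, intervalIntegral.integral_of_le (sub_nonneg.2 hu.2),
      ← integral_Icc_eq_integral_Ioc, ← integral_indicator measurableSet_Icc]
    congr 1 with v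
    have hiff : (u, v) ∈ refTriangle ↔ v ∈ Set.Icc 0 (1 - u) :=
      ⟨fun h => ⟨h.2.1, by have := h.2.2; simp only at this; linarith⟩,
        fun h => ⟨hu.1, h.1, by have := h.2; simp only; linarith⟩⟩
    by_cases hv : v ∈ Set.Icc 0 (1 - u)
    · rw [Set.indicator_of_mem hv, Set.indicator_of_mem (hiff.2 hv)]
    · rw [Set.indicator_of_notMem hv, Set.indicator_of_notMem (mt hiff.1 hv)]
  · rw [Set.indicator_of_notMem hu, ← integral_zero ℝ ℝ]
    congr 1 with v
    refine Set.indicator_of_notMem (fun h => hu ⟨h.1, ?_⟩) _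
    have h1 := h.2.1
    have h2 := h.2.2
    simp only at h1 h2
    linarith

lemma setIntegral_refTriangle_deriv_snd {g g' : ℝ × ℝ → ℝ}
    (hg' : ContinuousOn g' refTriangle)
    (hderiv : ∀ p ∈ refTriangle, HasDerivAt (fun v => g (p.1, v)) (g' p) p.2) :
    ∫ p in refTriangle, g' p = ∫ u in (0 : ℝ)..1, (g (u, 1 - u) - g (u, 0)) := by
  rw [setIntegral_refTriangle hg']
  refine intervalIntegral.integral_congr fun u hu => ?_
  rw [Set.uIcc_of_le zero_le_one] at hu
  have hmem : ∀ v ∈ Set.uIcc 0 (1 - u), (u, v) ∈ refTriangle := fun v hv => by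
    rw [Set.uIcc_of_le (sub_nonneg.2 hu.2)] at hv
    exact ⟨hu.1, hv.1, by have := hv.2; simp only; linarith⟩
  refine intervalIntegral.integral_eq_sub_of_hasDerivAt (f := fun v => g (u, v))
    (fun v hv => hderiv (u, v) (hmem v hv)) ?_
  exact (hg'.comp (by fun_prop) hmem).intervalIntegrable

lemma swap_preimage_refTriangle : Prod.swap ⁻¹' refTriangle = refTriangle := by
  ext ⟨u, v⟩
  simp only [refTriangle, Set.mem_preimage, Set.mem_ofPred_eq, Prod.fst_swap, Prod.snd_swap,
    add_comm v u]
  tauto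

lemma setIntegral_refTriangle_swap (g : ℝ × ℝ → ℝ) :
    ∫ p in refTriangle, g p.swap = ∫ p in refTriangle, g p := by
  have h := (Measure.measurePreserving_swap (μ := (volume : Measure ℝ))
    (ν := (volume : Measure ℝ))).setIntegral_preimage_emb
    MeasurableEquiv.prodComm.measurableEmbedding g refTriangle
  rwa [swap_preimage_refTriangle] at h

lemma setIntegral_refTriangle_deriv_fst {g g' : ℝ × ℝ → ℝ}
    (hg' : ContinuousOn g' refTriangle)
    (hderiv : ∀ p ∈ refTriangle, HasDerivAt (fun u => g (u, p.2)) (g' p) p.1) :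
    ∫ p in refTriangle, g' p = ∫ u in (0 : ℝ)..1, (g (u, 1 - u) - g (0, 1 - u)) := by
  have hswap : ∀ p ∈ refTriangle, p.swap ∈ refTriangle := fun p hp => by
    rwa [← swap_preimage_refTriangle] at hp
  rw [← setIntegral_refTriangle_swap, setIntegral_refTriangle_deriv_snd
    (g := fun p => g p.swap) (g' := fun p => g' p.swap) (hg'.comp continuous_swap.continuousOn hswap)
    (fun p hp => hderiv p.swap (hswap p hp))]
  have h := intervalIntegral.integral_comp_sub_left (a := 0) (b := 1)
    (fun u => g (u, 1 - u) - g (0, 1 - u)) (1 : ℝ)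
  simpa using h

/-- The divergence theorem on the reference triangle, for a field which is tangent to both legs. -/
lemma setIntegral_refTriangle_divergence {W : ℝ × ℝ → ℝ × ℝ} {W' : ℝ × ℝ → ℝ × ℝ →L[ℝ] ℝ × ℝ}
    (hW' : ContinuousOn W' refTriangle) (hW : ∀ p ∈ refTriangle, HasFDerivAt W (W' p) p)
    (hfst : ∀ v ∈ Set.Icc (0 : ℝ) 1, (W (0, v)).1 = 0)
    (hsnd : ∀ u ∈ Set.Icc (0 : ℝ) 1, (W (u, 0)).2 = 0) :
    ∫ p in refTriangle, ((W' p (1, 0)).1 + (W' p (0, 1)).2) =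
      ∫ u in (0 : ℝ)..1, ((W (u, 1 - u)).1 + (W (u, 1 - u)).2) := by
  have hc1 : ContinuousOn (fun p => (W' p (1, 0)).1) refTriangle :=
    (hW'.clm_apply continuousOn_const).fst
  have hc2 : ContinuousOn (fun p => (W' p (0, 1)).2) refTriangle :=
    (hW'.clm_apply continuousOn_const).snd
  have hWc : ContinuousOn W refTriangle := fun p hp => (hW p hp).continuousAt.continuousWithinAt
  have hd1 : ∀ p ∈ refTriangle,
      HasDerivAt (fun u => (W (u, p.2)).1) (W' p (1, 0)).1 p.1 := fun p hp =>
    (hW p hp).fst.comp_hasDerivAt (f := fun u => (u, p.2)) p.1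
      ((hasDerivAt_id p.1).prodMk (hasDerivAt_const p.1 p.2))
  have hd2 : ∀ p ∈ refTriangle,
      HasDerivAt (fun v => (W (p.1, v)).2) (W' p (0, 1)).2 p.2 := fun p hp =>
    (hW p hp).snd.comp_hasDerivAt (f := fun v => (p.1, v)) p.2
      ((hasDerivAt_const p.2 p.1).prodMk (hasDerivAt_id p.2))
  have hhyp : ∀ u ∈ Set.uIcc (0 : ℝ) 1, (u, 1 - u) ∈ refTriangle := fun u hu => by
    rw [Set.uIcc_of_le zero_le_one] at hu
    exact ⟨hu.1, sub_nonneg.2 hu.2, by simp⟩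
  have hWh : ContinuousOn (fun u : ℝ => W (u, 1 - u)) (Set.uIcc 0 1) :=
    hWc.comp (by fun_prop) hhyp
  rw [integral_add (hc1.integrableOn_compact isCompact_refTriangle)
      (hc2.integrableOn_compact isCompact_refTriangle),
    setIntegral_refTriangle_deriv_fst (g := fun p => (W p).1) hc1 hd1,
    setIntegral_refTriangle_deriv_snd (g := fun p => (W p).2) hc2 hd2,
    intervalIntegral.integral_add hWh.fst.intervalIntegrable hWh.snd.intervalIntegrable]
  congr 1 <;> refine intervalIntegral.integral_congr fun u hu => ?_ <;>
    rw [Set.uIcc_of_le zero_le_one] at hu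
  · simp [hfst (1 - u) ⟨sub_nonneg.2 hu.2, by linarith [hu.1]⟩]
  · simp [hsnd u hu]

lemma setIntegral_refTriangle_quadratic (a b c d e f : ℝ) :
    ∫ p in refTriangle, (a * p.1 ^ 2 + b * (p.1 * p.2) + c * p.2 ^ 2 + d * p.1 + e * p.2 + f) =
      a / 12 + b / 24 + c / 12 + d / 6 + e / 6 + f / 2 := by
  let g : ℝ × ℝ → ℝ := fun p => (a * p.1 ^ 2 + d * p.1 + f) * p.2 + (b * p.1 + e) * p.2 ^ 2 / 2
    + c * p.2 ^ 3 / 3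
  let h : ℝ → ℝ := fun u => (a * (u ^ 3 / 3 - u ^ 4 / 4) + d * (u ^ 2 / 2 - u ^ 3 / 3)
    + f * (u - u ^ 2 / 2)) + b / 2 * (u ^ 2 / 2 - 2 * u ^ 3 / 3 + u ^ 4 / 4)
    - e * (1 - u) ^ 3 / 6 - c * (1 - u) ^ 4 / 12
  rw [setIntegral_refTriangle_deriv_snd (g := g) (by fun_prop)]
  · rw [intervalIntegral.integral_eq_sub_of_hasDerivAt (f := h) (fun u _ => ?_)
      (Continuous.intervalIntegrable (by fun_prop) _ _)]
    · simp only [h]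
      ring
    · have h0 := hasDerivAt_id u
      have h1 := h0.const_sub 1
      refine ((((((((h0.pow 3).div_const 3).sub ((h0.pow 4).div_const 4)).const_mul a).add
        ((((h0.pow 2).div_const 2).sub ((h0.pow 3).div_const 3)).const_mul d)).add
        ((h0.sub ((h0.pow 2).div_const 2)).const_mul f)).add
        (((((h0.pow 2).div_const 2).sub (((h0.pow 3).const_mul 2).div_const 3)).add
          ((h0.pow 4).div_const 4)).const_mul (b / 2))).sub
        (((h1.pow 3).const_mul e).div_const 6)).sub
        (((h1.pow 4).const_mul c).div_const 12) |>.congr_deriv ?_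
      simp [g]
      ring
  · rintro ⟨u, v⟩ -
    have h0 := hasDerivAt_id v
    refine ((h0.const_mul (a * u ^ 2 + d * u + f)).add
      (((h0.pow 2).const_mul (b * u + e)).div_const 2)).add
      (((h0.pow 3).const_mul c).div_const 3) |>.congr_deriv ?_
    simp
    ring

lemma ContinuousLinearMap.trace_prod_self (B : ℝ × ℝ →L[ℝ] ℝ × ℝ) :
    LinearMap.trace ℝ (ℝ × ℝ) B.toLinearMap = (B (1, 0)).1 + (B (0, 1)).2 := by
  rw [LinearMap.trace_eq_matrix_trace ℝ (Module.Basis.finTwoProd ℝ), Matrix.trace_fin_two]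
  simp [LinearMap.toMatrix_apply]

section Triangle

variable {V : Type*} [NormedAddCommGroup V]

lemma exists_continuousLinearEquiv_of_linearIndependent [NormedSpace ℝ V]
    (hV : Module.finrank ℝ V = 2) {a b : V} (hab : LinearIndependent ℝ ![a, b]) :
    ∃ L : (ℝ × ℝ) ≃L[ℝ] V, ∀ p, L p = p.1 • a + p.2 • b := by
  have : FiniteDimensional ℝ V := Module.finite_of_finrank_eq_succ hV
  let f : ℝ × ℝ →ₗ[ℝ] V := (LinearMap.toSpanSingleton ℝ V a).coprod
    (LinearMap.toSpanSingleton ℝ V b)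
  have hf : Function.Injective f := by
    rw [injective_iff_map_eq_zero]
    rintro ⟨s, t⟩ h
    have := LinearIndependent.pair_iff.1 hab s t (by simpa [f] using h)
    simpa using this
  have hrank : Module.finrank ℝ (ℝ × ℝ) = Module.finrank ℝ V := by simp [hV]
  refine ⟨(LinearEquiv.ofInjectiveOfFinrankEq f hf hrank).toContinuousLinearEquiv,
    fun p => (DFunLike.congr_fun (LinearEquiv.coe_ofInjectiveOfFinrankEq f hf hrank) p).trans ?_⟩
  simp [f]

/-- The divergence theorem for `f • φ` on the image of the reference triangle under `p ↦ A + L p`,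
for a field `φ` of constant divergence which is tangent to the two sides through `A`. -/
lemma setIntegral_refTriangle_smul_divergence [NormedSpace ℝ V] (L : (ℝ × ℝ) ≃L[ℝ] V) (A : V)
    {φ : V → V} {U : Set V} (hU : IsOpen U) (hφ : ContDiffOn ℝ 1 φ U) {c : ℝ}
    (hmem : ∀ p ∈ refTriangle, A + L p ∈ U)
    (hdiv : ∀ p ∈ refTriangle, LinearMap.trace ℝ V (fderiv ℝ φ (A + L p)).toLinearMap = c)
    (hfst : ∀ v ∈ Set.Icc (0 : ℝ) 1, (L.symm (φ (A + L (0, v)))).1 = 0)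
    (hsnd : ∀ u ∈ Set.Icc (0 : ℝ) 1, (L.symm (φ (A + L (u, 0)))).2 = 0)
    {f : V → ℝ} {f' : V → V →L[ℝ] ℝ} (hf : ∀ x, HasFDerivAt f (f' x) x) (hf' : Continuous f') :
    ∫ p in refTriangle, (f (A + L p) * c + f' (A + L p) (φ (A + L p))) =
      ∫ u in (0 : ℝ)..1, f (A + L (u, 1 - u)) *
        ((L.symm (φ (A + L (u, 1 - u)))).1 + (L.symm (φ (A + L (u, 1 - u)))).2) := by
  have hF : ∀ p, HasFDerivAt (fun p => A + L p) (L : ℝ × ℝ →L[ℝ] V) p := fun p =>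
    L.hasFDerivAt.const_add A
  have hfc : Continuous f := continuous_iff_continuousAt.2 fun x => (hf x).continuousAt
  have hFc : Continuous fun p => A + L p := by fun_prop
  let Φ : ℝ × ℝ → ℝ × ℝ := fun p => L.symm (φ (A + L p))
  let Φ' : ℝ × ℝ → ℝ × ℝ →L[ℝ] ℝ × ℝ := fun p =>
    (L.symm : V →L[ℝ] ℝ × ℝ).comp ((fderiv ℝ φ (A + L p)).comp (L : ℝ × ℝ →L[ℝ] V))
  have hΦ : ∀ p ∈ refTriangle, HasFDerivAt Φ (Φ' p) p := fun p hp => by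
    have h := ((hφ.contDiffAt (hU.mem_nhds (hmem p hp))).differentiableAt one_ne_zero).hasFDerivAt
    exact L.symm.hasFDerivAt.comp p (h.comp p (hF p))
  have hΦc : ContinuousOn Φ refTriangle := fun p hp =>
    (hΦ p hp).continuousAt.continuousWithinAt
  have hΦ'c : ContinuousOn Φ' refTriangle :=
    continuousOn_const.clm_comp
      (((hφ.continuousOn_fderiv_of_isOpen hU le_rfl).comp hFc.continuousOn hmem).clm_comp
        continuousOn_const)
  have htrace : ∀ p ∈ refTriangle, (Φ' p (1, 0)).1 + (Φ' p (0, 1)).2 = c := fun p hp => by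
    rw [← ContinuousLinearMap.trace_prod_self, ← hdiv p hp]
    exact LinearMap.trace_conj' (fderiv ℝ φ (A + L p)).toLinearMap L.symm.toLinearEquiv
  have hLΦ : ∀ p, (Φ p).1 • L (1, 0) + (Φ p).2 • L (0, 1) = φ (A + L p) := fun p => by
    rw [← map_smul, ← map_smul, ← map_add]
    simp [Φ]
  have hdivW := setIntegral_refTriangle_divergence (W := fun p => f (A + L p) • Φ p)
    (W' := fun p => f (A + L p) • Φ' p +
      ((f' (A + L p)).comp (L : ℝ × ℝ →L[ℝ] V)).smulRight (Φ p)) ?_ ?_ ?_ ?_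
  · simp only [Prod.smul_fst, Prod.smul_snd, smul_eq_mul, ← mul_add] at hdivW
    rw [← hdivW]
    refine setIntegral_congr_fun measurableSet_refTriangle fun p hp => ?_
    simp only [← htrace p hp, ← hLΦ p]
    simp
    ring
  · refine ((hfc.comp hFc).continuousOn.smul hΦ'c).add ?_
    have h1 : ContinuousOn (fun p => (f' (A + L p)).comp (L : ℝ × ℝ →L[ℝ] V)) refTriangle :=
      (hf'.comp hFc).continuousOn.clm_comp continuousOn_const
    exact ((ContinuousLinearMap.smulRightL ℝ (ℝ × ℝ) (ℝ × ℝ)).continuous.comp_continuousOn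
      h1).clm_apply hΦc
  · exact fun p hp => ((hf _).comp p (hF p)).smul (hΦ p hp)
  · intro v hv
    simp [Φ, hfst v hv]
  · intro u hu
    simp [Φ, hsnd u hu]

lemma setIntegral_refTriangle_eq_zero [NormedSpace ℝ V] [MeasurableSpace V] [BorelSpace V]
    [FiniteDimensional ℝ V] (μ : Measure V) [μ.IsAddHaarMeasure]
    (L : (ℝ × ℝ) ≃L[ℝ] V) (A : V) {g : V → ℝ} {M : Set V}
    (hM : (fun p => A + L p) ⁻¹' M = refTriangle) (hg : ∫ x in M, g x ∂μ = 0) :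
    ∫ p in refTriangle, g (A + L p) = 0 := by
  let e : (ℝ × ℝ) ≃ᵐ V := (L.toHomeomorph.trans (Homeomorph.addLeft A)).toMeasurableEquiv
  have he : Measure.map e volume = Measure.map L volume := by
    have h : Measure.map (fun x => A + x) (Measure.map L volume) = Measure.map L volume :=
      map_add_left_eq_self _ A
    rwa [Measure.map_map (by fun_prop) L.continuous.measurable] at h
  have hk := Measure.isAddLeftInvariant_eq_smul (Measure.map L volume) μ
  have h := setIntegral_map_equiv (μ := volume) e g M
  rw [he, hk, Measure.restrict_smul, integral_smul_nnreal_measure, hg, smul_zero] at h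
  have hM' : e ⁻¹' M = refTriangle := hM
  rw [hM'] at h
  exact h.symm

lemma preimage_convexHull_triangle [NormedSpace ℝ V] {N E A : V} (L : (ℝ × ℝ) ≃L[ℝ] V)
    (hL : ∀ p, L p = p.1 • (N - A) + p.2 • (E - A)) :
    (fun p => A + L p) ⁻¹' convexHull ℝ {N, E, A} = refTriangle := by
  ext p
  rw [Set.mem_preimage]
  constructor
  · intro h
    rw [convexHull_insert (Set.insert_nonempty _ _), convexHull_pair, mem_convexJoin] at h
    obtain ⟨_, rfl, _, ⟨s, t, hs, ht, hst, rfl⟩, ⟨s', t', hs', ht', hst', hx⟩⟩ := h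
    have hp : p = (s', t' * s) := by
      apply L.injective
      rw [← add_right_inj A, ← hx, hL]
      obtain rfl : t = 1 - s := by linarith
      obtain rfl : s' = 1 - t' := by linarith
      module
    rw [hp]
    refine ⟨hs', mul_nonneg ht' hs, ?_⟩
    simp only
    nlinarith
  · rintro ⟨h1, h2, h3⟩
    have hx : A + L p = p.1 • N + p.2 • E + (1 - p.1 - p.2) • A := by
      rw [hL]
      module
    have h := (convex_convexHull ℝ {N, E, A}).sum_mem (t := Finset.univ)
      (w := ![p.1, p.2, 1 - p.1 - p.2]) (z := ![N, E, A]) ?_ ?_ ?_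
    · simpa [Fin.sum_univ_three, hx] using h
    · intro i _
      fin_cases i
      · exact h1
      · exact h2
      · simp only [Fin.reduceFinMk, Matrix.cons_val]
        linarith
    · simp [Fin.sum_univ_three]
    · intro i _
      apply subset_convexHull
      fin_cases i <;> simp

lemma AffineIndependent.linearIndependent_sub_third [NormedSpace ℝ V] {N E A : V}
    (h : AffineIndependent ℝ ![N, E, A]) : LinearIndependent ℝ ![N - A, E - A] := by
  rw [affineIndependent_iff_linearIndependent_vsub ℝ _ (2 : Fin 3)] at h
  let e : Fin 2 → {x : Fin 3 // x ≠ 2} := ![⟨0, by decide⟩, ⟨1, by decide⟩]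
  have he : Function.Injective e := by decide
  convert! h.comp e he using 1
  ext i
  fin_cases i <;> rfl

section InnerProduct

variable [InnerProductSpace ℝ V]

lemma exists_unit_orthogonal_of_linearIndependent {a b : V} (h : LinearIndependent ℝ ![a, b]) :
    ∃ ν : V, ‖ν‖ = 1 ∧ ⟪ν, a⟫ = 0 ∧ ⟪b, ν⟫ ≠ 0 := by
  have ha : a ≠ 0 := h.ne_zero 0
  have ha2 : ‖a‖ ^ 2 ≠ 0 := by positivity
  let w : V := ‖a‖ ^ 2 • b - ⟪a, b⟫ • a
  have hw : w ≠ 0 := fun hw => by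
    have := LinearIndependent.pair_iff.1 h (-⟪a, b⟫) (‖a‖ ^ 2) (by rw [← hw]; module)
    exact ha2 this.2
  have hwa : ⟪w, a⟫ = 0 := by
    simp only [w, inner_sub_left, real_inner_smul_left, real_inner_self_eq_norm_sq,
      real_inner_comm b a]
    ring
  have hwb : ‖a‖ ^ 2 * ⟪b, w⟫ = ‖w‖ ^ 2 := by
    rw [← real_inner_self_eq_norm_sq w]
    conv_rhs => rw [show w = ‖a‖ ^ 2 • b - ⟪a, b⟫ • a from rfl]
    rw [inner_sub_left, real_inner_smul_left, real_inner_smul_left]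
    change _ = ‖a‖ ^ 2 * ⟪b, w⟫ - ⟪a, b⟫ * ⟪a, w⟫
    rw [real_inner_comm a w] at hwa
    simp [hwa]
  refine ⟨‖w‖⁻¹ • w, ?_, ?_, ?_⟩
  · simp [norm_smul, hw]
  · simp [real_inner_smul_left, hwa]
  · rw [real_inner_smul_right]
    have : ‖w‖ ^ 2 ≠ 0 := by positivity
    refine mul_ne_zero (by simpa using hw) fun h0 => this ?_
    rw [← hwb, h0, mul_zero]

lemma setIntegral_refTriangle_norm_sq (a b d : V) :
    ∫ p in refTriangle, ‖d + p.1 • a + p.2 • b‖ ^ 2 =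
      (1 / 2) * ((1 / 36) * (‖a‖ ^ 2 + ‖b - a‖ ^ 2 + ‖b‖ ^ 2) +
        ‖d + (1 / 3 : ℝ) • (a + b)‖ ^ 2) := by
  have h : ∀ p : ℝ × ℝ, ‖d + p.1 • a + p.2 • b‖ ^ 2 = ‖a‖ ^ 2 * p.1 ^ 2 +
      (2 * ⟪a, b⟫) * (p.1 * p.2) + ‖b‖ ^ 2 * p.2 ^ 2 + (2 * ⟪d, a⟫) * p.1 + (2 * ⟪d, b⟫) * p.2
      + ‖d‖ ^ 2 := fun p => by
    simp only [← real_inner_self_eq_norm_sq, inner_add_left, inner_add_right,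
      real_inner_smul_left, real_inner_smul_right, real_inner_comm d a, real_inner_comm d b,
      real_inner_comm a b]
    ring
  simp only [h, setIntegral_refTriangle_quadratic]
  simp only [← real_inner_self_eq_norm_sq, inner_add_left, inner_add_right, inner_sub_left,
    inner_sub_right, real_inner_smul_left, real_inner_smul_right, real_inner_comm d a,
    real_inner_comm d b, real_inner_comm a b]
  ring

/-- The quadratic moment, about a point `C`, of the normal trace on the side opposite to `A`, for a
field of constant divergence which is tangent to the two other sides and orthogonal to
`x ↦ x - C`. -/
lemma integral_norm_sq_smul_normalTrace (L : (ℝ × ℝ) ≃L[ℝ] V) (A C : V)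
    {φ : V → V} {U : Set V} (hU : IsOpen U) (hφ : ContDiffOn ℝ 1 φ U) {c : ℝ}
    (hmem : ∀ p ∈ refTriangle, A + L p ∈ U)
    (hdiv : ∀ p ∈ refTriangle, LinearMap.trace ℝ V (fderiv ℝ φ (A + L p)).toLinearMap = c)
    (hfst : ∀ v ∈ Set.Icc (0 : ℝ) 1, (L.symm (φ (A + L (0, v)))).1 = 0)
    (hsnd : ∀ u ∈ Set.Icc (0 : ℝ) 1, (L.symm (φ (A + L (u, 0)))).2 = 0)
    (horth : ∫ p in refTriangle, ⟪φ (A + L p), A + L p - C⟫ = 0) :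
    ∫ u in (0 : ℝ)..1, ‖A + L (u, 1 - u) - C‖ ^ 2 *
        ((L.symm (φ (A + L (u, 1 - u)))).1 + (L.symm (φ (A + L (u, 1 - u)))).2) =
      c * ∫ p in refTriangle, ‖A + L p - C‖ ^ 2 := by
  have hFc : Continuous fun p => A + L p := by fun_prop
  have hφc : ContinuousOn (fun p => φ (A + L p)) refTriangle :=
    hφ.continuousOn.comp hFc.continuousOn hmem
  rw [← setIntegral_refTriangle_smul_divergence L A hU hφ hmem hdiv hfst hsnd
    (f := fun x => ‖x - C‖ ^ 2) (f' := fun x => 2 • innerSL ℝ (x - C))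
    (fun x => by simpa using ((hasFDerivAt_id x).sub_const C).norm_sq) (by fun_prop)]
  rw [integral_add]
  · rw [integral_mul_const, mul_comm c, add_eq_left]
    simp only [smul_apply, innerSL_apply_apply, real_inner_comm (φ _)]
    simp only [nsmul_eq_mul, integral_const_mul, horth, mul_zero]
  · exact ContinuousOn.integrableOn_compact isCompact_refTriangle (by fun_prop)
  · refine ContinuousOn.integrableOn_compact isCompact_refTriangle ?_
    simp only [smul_apply, innerSL_apply_apply]
    exact (ContinuousOn.inner (𝕜 := ℝ) (hFc.sub continuous_const).continuousOn hφc).const_smul 2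

end InnerProduct

end Triangle

/-- Proposition 3 ("First relations between momenta"), relations (3.11):
the moments of the normal trace `ψ(s) = ⟨φ(E + sτ), n⟩` of a dual Raviart–Thomas
basis function along the edge `EN` satisfy
`α₁ = ⟨G − E, τ⟩ α`, `α̃₁ = −⟨G − N, τ⟩ α`, `α₂ = (ρ_M² + ‖G − E‖²) α`,
`α̃₂ = (ρ_M² + ‖G − N‖²) α`. -/
theorem stmt6 (N E A : EuclideanSpace ℝ (Fin 2))
    (hindep : AffineIndependent ℝ ![N, E, A])
    (G : EuclideanSpace ℝ (Fin 2)) (hG : G = (1 / 3 : ℝ) • (N + E + A))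
    (ρM : ℝ)
    (hρ : ρM = Real.sqrt ((1 / 36) * (‖N - A‖ ^ 2 + ‖E - N‖ ^ 2 + ‖A - E‖ ^ 2)))
    (ℓ : ℝ) (hℓ : ℓ = ‖N - E‖)
    (τ n : EuclideanSpace ℝ (Fin 2))
    (hτ : τ = ℓ⁻¹ • (N - E))
    (hn1 : ‖n‖ = 1) (hn2 : ⟪n, N - E⟫ = 0) (hn3 : 0 < ⟪n, A - E⟫)
    (φ : EuclideanSpace ℝ (Fin 2) → EuclideanSpace ℝ (Fin 2))
    (U : Set (EuclideanSpace ℝ (Fin 2))) (hU : IsOpen U)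
    (hMU : convexHull ℝ {N, E, A} ⊆ U)
    (hφ : ContDiffOn ℝ 1 φ U)
    (c : ℝ)
    (hdiv : ∀ x ∈ convexHull ℝ ({N, E, A} : Set (EuclideanSpace ℝ (Fin 2))),
      LinearMap.trace ℝ (EuclideanSpace ℝ (Fin 2)) (fderiv ℝ φ x).toLinearMap = c)
    (hNA : ∀ x ∈ segment ℝ N A, ∀ ν : EuclideanSpace ℝ (Fin 2),
      ‖ν‖ = 1 → ⟪ν, A - N⟫ = 0 → ⟪φ x, ν⟫ = 0)
    (hEA : ∀ x ∈ segment ℝ E A, ∀ ν : EuclideanSpace ℝ (Fin 2),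
      ‖ν‖ = 1 → ⟪ν, A - E⟫ = 0 → ⟪φ x, ν⟫ = 0)
    (horthE : (∫ x in convexHull ℝ ({N, E, A} : Set (EuclideanSpace ℝ (Fin 2))),
      ⟪φ x, x - E⟫) = 0)
    (horthN : (∫ x in convexHull ℝ ({N, E, A} : Set (EuclideanSpace ℝ (Fin 2))),
      ⟪φ x, x - N⟫) = 0)
    (ψ : ℝ → ℝ) (hψ : ∀ s, ψ s = ⟪φ (E + s • τ), n⟫)
    (α α₁ α₁' α₂ α₂' : ℝ)
    (hα : α = ∫ s in (0 : ℝ)..ℓ, ψ s)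
    (hα₁ : α₁ = ∫ s in (0 : ℝ)..ℓ, s * ψ s)
    (hα₁' : α₁' = ∫ s in (0 : ℝ)..ℓ, (ℓ - s) * ψ s)
    (hα₂ : α₂ = ∫ s in (0 : ℝ)..ℓ, s ^ 2 * ψ s)
    (hα₂' : α₂' = ∫ s in (0 : ℝ)..ℓ, (ℓ - s) ^ 2 * ψ s) :
    α₁ = ⟪G - E, τ⟫ * α ∧
    α₁' = -⟪G - N, τ⟫ * α ∧
    α₂ = (ρM ^ 2 + ‖G - E‖ ^ 2) * α ∧
    α₂' = (ρM ^ 2 + ‖G - N‖ ^ 2) * α := by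
  set a := N - A with ha
  set b := E - A with hb
  have hab : LinearIndependent ℝ ![a, b] := hindep.linearIndependent_sub_third
  obtain ⟨L, hL⟩ := exists_continuousLinearEquiv_of_linearIndependent (by simp) hab
  have hN : N = A + a := by simp [ha]
  have hE : E = A + b := by simp [hb]
  have hNE : N - E = a - b := by simp [ha, hb]
  have hne : a - b ≠ 0 := fun h0 => by
    have := LinearIndependent.pair_iff.1 hab 1 (-1) (by rw [← h0]; module)
    exact one_ne_zero this.1
  rw [hNE] at hℓ hτ hn2
  have hℓ0 : ℓ ≠ 0 := by simpa [hℓ] using hne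
  have hℓτ : ℓ • τ = a - b := by rw [hτ, smul_inv_smul₀ hℓ0]
  have hM := preimage_convexHull_triangle L hL
  have hmemM : ∀ p ∈ refTriangle, A + L p ∈ convexHull ℝ {N, E, A} := fun p hp => by
    rwa [← hM] at hp
  have hmem : ∀ p ∈ refTriangle, A + L p ∈ U := fun p hp => hMU (hmemM p hp)
  have hdivT : ∀ p ∈ refTriangle,
      LinearMap.trace ℝ _ (fderiv ℝ φ (A + L p)).toLinearMap = c := fun p hp =>
    hdiv _ (hmemM p hp)
  have hcoord : ∀ x ν, ⟪φ x, ν⟫ = (L.symm (φ x)).1 * ⟪a, ν⟫ + (L.symm (φ x)).2 * ⟪b, ν⟫ :=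
    fun x ν => by
      conv_lhs => rw [← L.apply_symm_apply (φ x), hL]
      simp only [inner_add_left, real_inner_smul_left]
  have hfst : ∀ v ∈ Set.Icc (0 : ℝ) 1, (L.symm (φ (A + L (0, v)))).1 = 0 := fun v hv => by
    obtain ⟨ν, hν, hν', hν0⟩ :=
      exists_unit_orthogonal_of_linearIndependent (LinearIndependent.pair_symm_iff.1 hab)
    have h := hEA (A + L (0, v)) ?_ ν hν ?_
    · rw [hcoord, real_inner_comm ν b, hν', mul_zero, add_zero] at h
      exact (mul_eq_zero.1 h).resolve_right hν0
    · rw [segment_symm, segment_eq_image']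
      exact ⟨v, hv, by simp [hL, hb]⟩
    · rw [← neg_sub E A, inner_neg_right, ← hb, hν', neg_zero]
  have hsnd : ∀ u ∈ Set.Icc (0 : ℝ) 1, (L.symm (φ (A + L (u, 0)))).2 = 0 := fun u hu => by
    obtain ⟨ν, hν, hν', hν0⟩ := exists_unit_orthogonal_of_linearIndependent hab
    have h := hNA (A + L (u, 0)) ?_ ν hν ?_
    · rw [hcoord, real_inner_comm ν a, hν', mul_zero, zero_add] at h
      exact (mul_eq_zero.1 h).resolve_right hν0
    · rw [segment_symm, segment_eq_image']
      exact ⟨u, hu, by simp [hL, ha]⟩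
    · rw [← neg_sub N A, inner_neg_right, ← ha, hν', neg_zero]
  let S : ℝ → ℝ := fun u =>
    (L.symm (φ (A + L (u, 1 - u)))).1 + (L.symm (φ (A + L (u, 1 - u)))).2
  have hhyp : ∀ u, A + L (u, 1 - u) = E + u • (a - b) := fun u => by
    rw [hL, hE]
    module
  have hψS : ∀ u, ψ (ℓ * u) = ⟪a, n⟫ * S u := fun u => by
    have hbn : ⟪b, n⟫ = ⟪a, n⟫ := by
      rw [real_inner_comm, inner_sub_left] at hn2
      linarith
    rw [hψ, mul_comm, mul_smul, hℓτ, ← hhyp, hcoord, hbn]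
    ring
  have hmoment : ∀ g : ℝ → ℝ, ∫ s in (0 : ℝ)..ℓ, g s * ψ s =
      ℓ * ⟪a, n⟫ * ∫ u in (0 : ℝ)..1, g (ℓ * u) * S u := fun g => by
    have h := intervalIntegral.mul_integral_comp_mul_left (a := 0) (b := 1)
      (f := fun s => g s * ψ s) ℓ
    rw [mul_zero, mul_one] at h
    rw [← h, mul_assoc, ← intervalIntegral.integral_const_mul ⟪a, n⟫]
    congr 2 with u
    rw [hψS]
    ring
  have hS : ∫ u in (0 : ℝ)..1, S u = c * (1 / 2) := by
    have h := setIntegral_refTriangle_smul_divergence L A hU hφ hmem hdivT hfst hsnd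
      (f := fun _ => 1) (f' := fun _ => 0) (fun x => hasFDerivAt_const _ _) continuous_const
    have hc := setIntegral_refTriangle_quadratic 0 0 0 0 0 c
    simp only [one_mul, zero_apply, add_zero] at h
    simp only [zero_mul, zero_add, zero_div] at hc
    rw [← h, hc]
    ring
  have hα0 : α = ℓ * ⟪a, n⟫ * (c * (1 / 2)) := by
    rw [hα, ← hS]
    simpa using hmoment fun _ => 1
  have hρ2 : ρM ^ 2 = (1 / 36) * (‖a‖ ^ 2 + ‖b - a‖ ^ 2 + ‖b‖ ^ 2) := by
    rw [hρ, Real.sq_sqrt (by positivity), norm_sub_rev A E, ← hb, norm_sub_rev E N, hNE,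
      norm_sub_rev a b]
  have hquad : ∀ C : EuclideanSpace ℝ (Fin 2),
      (∫ x in convexHull ℝ ({N, E, A} : Set (EuclideanSpace ℝ (Fin 2))), ⟪φ x, x - C⟫) = 0 →
      ℓ * ⟪a, n⟫ * ∫ u in (0 : ℝ)..1, ‖A + L (u, 1 - u) - C‖ ^ 2 * S u =
        (ρM ^ 2 + ‖G - C‖ ^ 2) * α := fun C hC => by
    rw [integral_norm_sq_smul_normalTrace L A C hU hφ hmem hdivT hfst hsnd
      (setIntegral_refTriangle_eq_zero volume L A (g := fun x => ⟪φ x, x - C⟫) hM hC)]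
    have h1 : ∀ p, A + L p - C = (A - C) + p.1 • a + p.2 • b := fun p => by
      rw [hL]
      abel
    have h2 : G - C = (A - C) + (1 / 3 : ℝ) • (a + b) := by
      rw [hG, hN, hE]
      module
    simp only [h1, setIntegral_refTriangle_norm_sq, hρ2, h2, hα0]
    ring
  have h2 : α₂ = (ρM ^ 2 + ‖G - E‖ ^ 2) * α := by
    rw [← hquad E horthE, hα₂, hmoment fun s => s ^ 2]
    congr 2 with u
    rw [hhyp, add_sub_cancel_left, norm_smul, ← hℓ, Real.norm_eq_abs, mul_pow |_|, sq_abs]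
    ring
  have h2' : α₂' = (ρM ^ 2 + ‖G - N‖ ^ 2) * α := by
    rw [← hquad N horthN, hα₂', hmoment fun s => (ℓ - s) ^ 2]
    congr 2 with u
    have : E + u • (a - b) - N = (u - 1) • (a - b) := by
      rw [hN, hE]
      module
    rw [hhyp, this, norm_smul, ← hℓ, Real.norm_eq_abs, mul_pow |_|, sq_abs]
    ring
  have hψc : ContinuousOn ψ (Set.uIcc 0 ℓ) := by
    have hmaps : Set.MapsTo (fun s : ℝ => E + s • τ) (Set.uIcc 0 ℓ) U := fun s hs => by
      have hℓpos : 0 < ℓ := lt_of_le_of_ne (hℓ ▸ norm_nonneg _) hℓ0.symm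
      rw [Set.uIcc_of_le hℓpos.le] at hs
      have hsℓ : E + s • τ = A + L (s / ℓ, 1 - s / ℓ) := by
        rw [hhyp, ← hℓτ, smul_smul, div_mul_cancel₀ _ hℓ0]
      change E + s • τ ∈ U
      rw [hsℓ]
      exact hmem _ ⟨div_nonneg hs.1 hℓpos.le, sub_nonneg.2 ((div_le_one hℓpos).2 hs.2), by simp⟩
    rw [show ψ = fun s => ⟪φ (E + s • τ), n⟫ from funext hψ]
    exact ContinuousOn.inner (𝕜 := ℝ) (hφ.continuousOn.comp (by fun_prop) hmaps) continuousOn_const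
  have hi0 : IntervalIntegrable ψ volume 0 ℓ := hψc.intervalIntegrable
  have hi1 : IntervalIntegrable (fun s => s * ψ s) volume 0 ℓ :=
    (continuousOn_id.mul hψc).intervalIntegrable
  have hi2 : IntervalIntegrable (fun s => s ^ 2 * ψ s) volume 0 ℓ :=
    ((continuousOn_id.pow 2).mul hψc).intervalIntegrable
  have hlin : α₁' = ℓ * α - α₁ := by
    rw [hα₁', hα, hα₁, ← intervalIntegral.integral_const_mul,
      ← intervalIntegral.integral_sub (hi0.const_mul ℓ) hi1]
    congr 1 with s
    ring
  have hsq : α₂' = ℓ ^ 2 * α - 2 * ℓ * α₁ + α₂ := by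
    rw [hα₂', hα, hα₁, hα₂, ← intervalIntegral.integral_const_mul,
      ← intervalIntegral.integral_const_mul,
      ← intervalIntegral.integral_sub (hi0.const_mul _) (hi1.const_mul _),
      ← intervalIntegral.integral_add ((hi0.const_mul _).sub (hi1.const_mul _)) hi2]
    congr 1 with s
    ring
  have hGN : G - N = (G - E) - ℓ • τ := by
    rw [hℓτ, hN, hE]
    abel
  have hττ : ⟪τ, τ⟫ = 1 := by
    rw [real_inner_self_eq_norm_sq, hτ, norm_smul, ← hℓ, mul_pow, norm_inv,
      Real.norm_eq_abs, inv_pow, sq_abs, inv_mul_cancel₀ (pow_ne_zero 2 hℓ0)]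
  have hGN2 : ‖G - N‖ ^ 2 = ‖G - E‖ ^ 2 - 2 * ℓ * ⟪G - E, τ⟫ + ℓ ^ 2 := by
    rw [hGN, norm_sub_sq_real, real_inner_smul_right, ← real_inner_self_eq_norm_sq (ℓ • τ),
      real_inner_smul_left, real_inner_smul_right, hττ]
    ring
  have h1 : α₁ = ⟪G - E, τ⟫ * α := by
    refine mul_left_cancel₀ (mul_ne_zero two_ne_zero hℓ0) ?_
    rw [hGN2] at h2'
    linear_combination hsq - h2' + h2
  refine ⟨h1, ?_, h2, h2'⟩
  rw [hlin, hGN, inner_sub_left, real_inner_smul_left, hττ, h1]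
  ring
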